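/- Let Γ̃_(n) be the Gelfand–Graev character of G_n = GL(n, F_q). Then Γ̃_(n) vanishes on all non-unipotent conjugacy classes, and its value on a unipotent class of type μ ⊢ n equals (−1)^{n − ℓ(μ)} · Π_{i=1}^{ℓ(μ)} (q^i − 1). -/

import Mathlib

/-!
Common framework for a formalization of statements from
"Gelfand–Graev characters of the finite unitary groups" (Thiem–Vinroot).
-/

open scoped Classical

noncomputable section

namespace GGU

/-! ### Partitions -/

/-- A partition, encoded as a weakly decreasing, finitely supported sequence of
natural numbers; `parts i` is the `i`-th part `λ_i` for `i ≥ 1`, and `parts 0 = 0`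
by convention. -/
structure Partn where
  parts : ℕ → ℕ
  parts_zero : parts 0 = 0
  parts_antitone : ∀ ⦃i j : ℕ⦄, 1 ≤ i → i ≤ j → parts j ≤ parts i
  parts_finite : {i : ℕ | parts i ≠ 0}.Finite

/-- The size `|λ|` of a partition. -/
def Partn.size (l : Partn) : ℕ := ∑ᶠ i, l.parts i

/-- The length `ℓ(λ)` (number of nonzero parts) of a partition. -/
def Partn.len (l : Partn) : ℕ := {i : ℕ | l.parts i ≠ 0}.ncard

/-- The statistic `n(λ) = ∑ (i-1)·λ_i`. -/
def Partn.nstat (l : Partn) : ℕ := ∑ᶠ i, (i - 1) * l.parts i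

/-- The multiplicity `m_k(λ)` of the part `k ≥ 1` in `λ`. -/
def Partn.mult (l : Partn) (k : ℕ) : ℕ := {i : ℕ | 1 ≤ i ∧ l.parts i = k}.ncard

/-- `z_λ = ∏_k k^{m_k} m_k!`. -/
def Partn.zee (l : Partn) : ℕ := ∏ᶠ k, k ^ l.mult k * (l.mult k).factorial

/-- The cell `(i,j)` (row `i ≥ 1`, column `j ≥ 1`) lies in the Young diagram of `λ`. -/
def Partn.cell (l : Partn) (c : ℕ × ℕ) : Prop := 1 ≤ c.1 ∧ 1 ≤ c.2 ∧ c.2 ≤ l.parts c.1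

/-- The empty partition. -/
def Partn.empty : Partn where
  parts := fun _ => 0
  parts_zero := rfl
  parts_antitone := fun _ _ _ _ => le_rfl
  parts_finite := by simp

/-- The one-row partition `(m)`. -/
def Partn.ofRow (m : ℕ) : Partn where
  parts := fun i => if i = 1 then m else 0
  parts_zero := by simp
  parts_antitone := by
    intro i j hi hij
    by_cases hj : j = 1
    · have hi1 : i = 1 := by omega
      simp [hj, hi1]
    · simp [hj]
  parts_finite := Set.Finite.subset (Set.finite_singleton 1) (by
    intro i hi
    by_cases h : i = 1 <;> simp_all)

/-- Partial sums `λ_1 + ⋯ + λ_k`. -/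
def Partn.cumul (l : Partn) (k : ℕ) : ℕ := ∑ t ∈ Finset.range k, l.parts (t + 1)

/-- Strict dominance order on partitions of the same size. -/
def DomLt (l m : Partn) : Prop :=
  l.size = m.size ∧ l ≠ m ∧ ∀ k, l.cumul k ≤ m.cumul k

/-- The set `{ν_{≤ 1}, ν_{≤ 2}, …}` of partial sums of a partition `ν`. -/
def cumSet (nu : Partn) : Set ℕ := {m : ℕ | ∃ j, 1 ≤ j ∧ m = nu.cumul j}

/-- Lexicographic order on weight sequences. -/
def LexLE (f g : ℕ → ℕ) : Prop := f = g ∨ ∃ k, f k < g k ∧ ∀ j < k, f j = g j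

/-! ### Dominoes, 2-cores and 2-quotients -/

/-- Two cells are adjacent (horizontally or vertically). -/
def adjCell (c d : ℕ × ℕ) : Prop :=
  (c.1 = d.1 ∧ (c.2 + 1 = d.2 ∨ d.2 + 1 = c.2)) ∨
  (c.2 = d.2 ∧ (c.1 + 1 = d.1 ∨ d.1 + 1 = c.1))

/-- `DomStep μ ρ` : the partition `ρ` is obtained from `μ` by removing one domino. -/
def DomStep (mu rho : Partn) : Prop :=
  (∀ i, rho.parts i ≤ mu.parts i) ∧
  ∃ c d : ℕ × ℕ, c ≠ d ∧ adjCell c d ∧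
    mu.cell c ∧ mu.cell d ∧ ¬ rho.cell c ∧ ¬ rho.cell d ∧
    ∀ e : ℕ × ℕ, mu.cell e → ¬ rho.cell e → e = c ∨ e = d

/-- `γ` is the 2-core of `λ`: it is obtained from `λ` by successively removing
dominoes, and admits no further domino removal. -/
def TwoCore (lam gam : Partn) : Prop :=
  Relation.ReflTransGen DomStep lam gam ∧ ∀ rho, ¬ DomStep gam rho

/-- `core₂(λ) ∈ {∅, (1)}`. -/
def core2small (lam : Partn) : Prop := ∃ gam, TwoCore lam gam ∧ gam.size ≤ 1

/-- The size `|core₂(λ)|` of the 2-core of `λ`. -/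
def core2size (lam : Partn) : ℕ := sInf {s | ∃ gam, TwoCore lam gam ∧ gam.size = s}

/-- The `j`-th part of one member (`ε ∈ {0,1}`) of the 2-quotient of `λ`,
computed from the β-set `{λ_t + N - t : 1 ≤ t ≤ N}` with `N = 2(|λ|+1)`. -/
def quot2part (lam : Partn) (ε : ℕ) (j : ℕ) : ℕ :=
  let N := 2 * (lam.size + 1)
  let B := (Finset.range N).image fun t => lam.parts (t + 1) + (N - (t + 1))
  let L := (B.filter fun b => b % 2 = ε).sort (· ≤ ·)
  if 1 ≤ j ∧ j ≤ L.length then (L.getD (L.length - j) 0) / 2 - (L.length - j) else 0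

/-- `quot₂(λ)_j`, the sum of the `j`-th parts of the two members of the 2-quotient. -/
def quot2sum (lam : Partn) (j : ℕ) : ℕ := quot2part lam 0 j + quot2part lam 1 j

/-! ### Tableaux -/

/-- A semistandard (column-strict) Young tableau of shape `λ` with entries in `{1,2,…}`. -/
structure SSYT (lam : Partn) where
  entry : ℕ × ℕ → ℕ
  entry_pos : ∀ c, lam.cell c → 1 ≤ entry c
  entry_outside : ∀ c, ¬ lam.cell c → entry c = 0
  row_weak : ∀ i j : ℕ, lam.cell (i, j + 1) → entry (i, j) ≤ entry (i, j + 1)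
  col_strict : ∀ i j : ℕ, 1 ≤ i → lam.cell (i + 1, j) → entry (i, j) < entry (i + 1, j)

/-- The number of entries equal to `k` in a semistandard tableau. -/
def SSYT.wt {lam : Partn} (T : SSYT lam) (k : ℕ) : ℕ :=
  {c : ℕ × ℕ | lam.cell c ∧ T.entry c = k}.ncard

/-- A symplectic tableau: a column strict filling of `λ` by the symbols
`0 < 1̄ < 1 < 2̄ < 2 < ⋯`, where the symbol `0` is encoded by `0`, `k̄` by `2k-1`
and `k` by `2k`. -/
structure SympTab (lam : Partn) where
  entry : ℕ × ℕ → ℕ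
  entry_outside : ∀ c, ¬ lam.cell c → entry c = 0
  row_weak : ∀ i j : ℕ, lam.cell (i, j + 1) → entry (i, j) ≤ entry (i, j + 1)
  col_strict : ∀ i j : ℕ, 1 ≤ i → lam.cell (i + 1, j) → entry (i, j) < entry (i + 1, j)

/-- The weight of a symplectic tableau: `wt 0` is the number of `0`'s, and for
`k ≥ 1`, `wt k` is the number of `k̄`'s plus the number of `k`'s. -/
def SympTab.wt {lam : Partn} (T : SympTab lam) (k : ℕ) : ℕ :=
  if k = 0 then {c : ℕ × ℕ | lam.cell c ∧ T.entry c = 0}.ncard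
  else {c : ℕ × ℕ | lam.cell c ∧ (T.entry c = 2 * k - 1 ∨ T.entry c = 2 * k)}.ncard

/-- The cells of `λ/(m₀)`: cells of `λ` other than the `m₀` leftmost cells of the
first row. -/
def Partn.tiled (lam : Partn) (m0 : ℕ) (c : ℕ × ℕ) : Prop :=
  lam.cell c ∧ ¬ (c.1 = 1 ∧ c.2 ≤ m0)

/-- A (semistandard) domino tableau of shape `λ/(m₀)`: a column strict filling of a
tiling of `λ/(m₀)` by dominoes, with `0`'s in the `m₀` non-tiled boxes.  The tiling is
recorded by the involution `mate` matching each tiled cell with the other cell of its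
domino. -/
structure DomTab (lam : Partn) (m0 : ℕ) where
  m0_le : m0 ≤ lam.parts 1
  entry : ℕ × ℕ → ℕ
  mate : ℕ × ℕ → ℕ × ℕ
  entry_pos : ∀ c, lam.tiled m0 c → 1 ≤ entry c
  entry_zero : ∀ c, ¬ lam.tiled m0 c → entry c = 0
  mate_tiled : ∀ c, lam.tiled m0 c → lam.tiled m0 (mate c)
  mate_id : ∀ c, ¬ lam.tiled m0 c → mate c = c
  mate_invol : ∀ c, mate (mate c) = c
  mate_adj : ∀ c, lam.tiled m0 c → adjCell c (mate c)
  mate_entry : ∀ c, entry (mate c) = entry c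
  row_weak : ∀ i j : ℕ, lam.cell (i, j + 1) → entry (i, j) ≤ entry (i, j + 1)
  col_strict : ∀ i j : ℕ, 1 ≤ i → lam.cell (i + 1, j) → mate (i, j) ≠ (i + 1, j) →
    entry (i, j) < entry (i + 1, j)

/-- The weight of a domino tableau: `wt k` is the number of dominoes labelled `k`. -/
def DomTab.wt {lam : Partn} {m0 : ℕ} (T : DomTab lam m0) (k : ℕ) : ℕ :=
  {c : ℕ × ℕ | lam.tiled m0 c ∧ T.entry c = k}.ncard / 2

/-! ### Θ-partitions and battery tableaux -/

/-- A `Θ`-partition: an assignment of a partition to each element of the index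
type `Th` (the set of Frobenius orbits), with finite support. -/
structure TPartn (Th : Type) where
  lam : Th → Partn
  finite : {φ : Th | lam φ ≠ Partn.empty}.Finite

/-- The size `|λ| = ∑_φ |φ|·|λ^{(φ)}|` of a `Θ`-partition, where `deg φ` is the
orbit size `|φ|`. -/
def TPartn.size {Th : Type} (deg : Th → ℕ) (l : TPartn Th) : ℕ :=
  ∑ᶠ φ, deg φ * (l.lam φ).size

/-- `n(λ) = ∑_φ |φ|·n(λ^{(φ)})` for a `Θ`-partition. -/
def TPartn.nstat {Th : Type} (deg : Th → ℕ) (l : TPartn Th) : ℕ :=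
  ∑ᶠ φ, deg φ * (l.lam φ).nstat

/-- A battery `Θ`-tableau of shape `λ/γ` (with `hgt(γ) ≤ 1`, so that `γ^{(φ)}` is the
one-row partition `(γ^{(φ)}_1)`): a domino tableau of shape `λ^{(φ)}/(γ^{(φ)}_1)` for each
`φ` with `|φ|` odd, and a symplectic tableau of shape `λ^{(φ)}/(γ^{(φ)}_1)` for each `φ`
with `|φ|` even. -/
structure BatteryTab {Th : Type} (deg : Th → ℕ) (lam gam : Th → Partn) where
  dom : ∀ φ, Odd (deg φ) → DomTab (lam φ) ((gam φ).parts 1)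
  symp : ∀ φ, ¬ Odd (deg φ) → SympTab (lam φ)
  symp_wt0 : ∀ φ (h : ¬ Odd (deg φ)), (symp φ h).wt 0 = (gam φ).parts 1

/-- The weight of a battery tableau:
`wt(Q)_i = ∑_{|φ| odd} |φ|·wt(Q^{(φ)})_i + ∑_{|φ| even} (|φ|/2)·wt(Q^{(φ)})_i`. -/
def BatteryTab.wt {Th : Type} {deg : Th → ℕ} {lam gam : Th → Partn}
    (T : BatteryTab deg lam gam) (i : ℕ) : ℕ :=
  ∑ᶠ φ : Th, if h : Odd (deg φ) then deg φ * (T.dom φ h).wt i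
    else (deg φ / 2) * (T.symp φ h).wt i

/-- The set `B^λ_{(k,ν)}` of battery tableaux of shape `λ/γ`, for some `Θ`-partition
`γ` of size `k` with `hgt(γ) ≤ 1`, and of weight `ν`. -/
structure Battery {Th : Type} (deg : Th → ℕ) (lam : TPartn Th) (k : ℕ) (nu : Partn) where
  gam : TPartn Th
  gam_size : TPartn.size deg gam = k
  gam_hgt : ∀ φ, (gam.lam φ).len ≤ 1
  gam_le : ∀ φ, (gam.lam φ).parts 1 ≤ (lam.lam φ).parts 1
  tab : BatteryTab deg lam.lam gam.lam
  tab_wt : ∀ i, 1 ≤ i → tab.wt i = nu.parts i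

/-! ### Symmetric functions as formal power series -/

/-- The Schur function `s_λ` in the variables `X_0, X_1, X_2, …`, defined
combinatorially: the coefficient of a monomial is the number of semistandard Young
tableaux of shape `λ` with the corresponding content. -/
def sSchur (lam : Partn) : MvPowerSeries ℕ ℂ :=
  fun d => (Nat.card {T : SSYT lam // ∀ k, 1 ≤ k → T.wt k = d (k - 1)} : ℂ)

/-- The Schur function `s_λ(Y^{(φ)})` in the variable family `Y^{(φ)}`, inside the ring
of symmetric functions in the variables `{Y^{(φ)}_j : φ ∈ Θ, j ∈ ℕ}`. -/
def sSchurAt {Th : Type} (φ : Th) (lam : Partn) : MvPowerSeries (Th × ℕ) ℂ :=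
  fun d => if ∀ x ∈ d.support, x.1 = φ then
    (Nat.card {T : SSYT lam // ∀ k, 1 ≤ k → T.wt k = d (φ, k - 1)} : ℂ) else 0

/-- `s_λ = ∏_φ s_{λ^{(φ)}}(Y^{(φ)})` for a `Θ`-partition `λ`. -/
def sTheta {Th : Type} (l : TPartn Th) : MvPowerSeries (Th × ℕ) ℂ :=
  ∏ᶠ φ, sSchurAt φ (l.lam φ)

/-- The monomial symmetric function `m_λ`. -/
def msym (l : Partn) : MvPowerSeries ℕ ℂ :=
  fun d => if d.support.val.map (fun i => d i) = l.parts_finite.toFinset.val.map l.parts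
    then 1 else 0

/-- The power sum `p_k = ∑_i X_i^k` (with `p_0 = 1` by convention). -/
def ppow (k : ℕ) : MvPowerSeries ℕ ℂ :=
  if k = 0 then 1
  else fun d => if ∃ i : ℕ, d = Finsupp.single i k then 1 else 0

/-- The power sum symmetric function `p_ν = p_{ν_1} p_{ν_2} ⋯`. -/
def psym (l : Partn) : MvPowerSeries ℕ ℂ := ∏ᶠ i, ppow (l.parts i)

/-- Plethysm with the power sum `p_2`: `(f ∘ p_2)(X_0, X_1, …) = f(X_0^2, X_1^2, …)`. -/
def plet2 (F : MvPowerSeries ℕ ℂ) : MvPowerSeries ℕ ℂ :=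
  fun d => if ∀ i, 2 ∣ d i
    then F (Finsupp.mapRange (· / 2) (Nat.zero_div 2) d) else 0



/-! ### The finite groups: `GL(n, F_{p^r})` and `U(n, F_{q²})` inside `GL(n, F̄_p)` -/

/-- An algebraic closure `F̄_p` of the prime field. -/
abbrev Fbar (p : ℕ) [Fact p.Prime] : Type := AlgebraicClosure (ZMod p)

/-- The field endomorphism `x ↦ x^{p^r}` of `F̄_p`. -/
def frobPow (p : ℕ) [Fact p.Prime] (r : ℕ) : Fbar p →+* Fbar p :=
  haveI : CharP (Fbar p) p :=
    charP_of_injective_algebraMap (algebraMap (ZMod p) (Fbar p)).injective p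
  haveI : ExpChar (Fbar p) p := ExpChar.prime Fact.out
  iterateFrobenius (Fbar p) p r

/-- The entrywise Frobenius `(a_{ij}) ↦ (a_{ij}^{p^r})` on `GL(n, F̄_p)`. -/
def entryFrobGL (p : ℕ) [Fact p.Prime] (r n : ℕ) :
    (Matrix (Fin n) (Fin n) (Fbar p))ˣ →* (Matrix (Fin n) (Fin n) (Fbar p))ˣ :=
  Units.map ((frobPow p r).mapMatrix.toMonoidHom)

/-- `GL(n, F_{p^r})`, realized as the fixed points of the entrywise Frobenius
`(a_{ij}) ↦ (a_{ij}^{p^r})` on `GL(n, F̄_p)`. -/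
def GLfix (p : ℕ) [Fact p.Prime] (r n : ℕ) : Subgroup (Matrix (Fin n) (Fin n) (Fbar p))ˣ where
  carrier := {A | entryFrobGL p r n A = A}
  one_mem' := by simp
  mul_mem' := by
    intro a b ha hb
    simp only [Set.mem_setOf_eq, map_mul] at *
    rw [ha, hb]
  inv_mem' := by
    intro a ha
    simp only [Set.mem_setOf_eq, map_inv] at *
    rw [ha]

/-- The anti-transpose `(M^{at})_{ij} = M_{n+1-j, n+1-i}` of a matrix. -/
def atrans {n : ℕ} {K : Type*} (M : Matrix (Fin n) (Fin n) K) : Matrix (Fin n) (Fin n) K :=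
  Matrix.of fun i j => M (Fin.rev j) (Fin.rev i)

lemma atrans_one {n : ℕ} {K : Type*} [NonAssocSemiring K] :
    atrans (1 : Matrix (Fin n) (Fin n) K) = 1 := by
  ext i j
  simp only [atrans, Matrix.of_apply, Matrix.one_apply, Fin.rev_inj]
  by_cases h : i = j
  · simp [h]
  · simp [h, Ne.symm h]

lemma atrans_mul {n : ℕ} {K : Type*} [CommSemiring K] (M N : Matrix (Fin n) (Fin n) K) :
    atrans (M * N) = atrans N * atrans M := by
  ext i j
  simp only [atrans, Matrix.of_apply, Matrix.mul_apply]
  exact Fintype.sum_equiv Fin.revPerm _ _ (fun k => by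
    simp [Fin.rev_rev, mul_comm])

/-- The twisted Frobenius `F'(A) = (ᵃ(A^{p^f}))⁻¹` (entrywise `q = p^f` power, followed by
anti-transpose-inverse) on `GL(n, F̄_p)`, whose fixed point group is the finite unitary
group `U(n, F_{q²})`. -/
def unitaryFrob (p : ℕ) [Fact p.Prime] (fexp n : ℕ) :
    (Matrix (Fin n) (Fin n) (Fbar p))ˣ →* (Matrix (Fin n) (Fin n) (Fbar p))ˣ where
  toFun A :=
    { val := atrans ((frobPow p fexp).mapMatrix A.inv)
      inv := atrans ((frobPow p fexp).mapMatrix A.val)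
      val_inv := by
        rw [← atrans_mul, ← map_mul, A.val_inv, map_one, atrans_one]
      inv_val := by
        rw [← atrans_mul, ← map_mul, A.inv_val, map_one, atrans_one] }
  map_one' := by
    apply Units.ext
    show atrans ((frobPow p fexp).mapMatrix (1 : Matrix (Fin n) (Fin n) (Fbar p))) = _
    rw [map_one, atrans_one]
    rfl
  map_mul' := by
    intro A B
    apply Units.ext
    show atrans ((frobPow p fexp).mapMatrix (B.inv * A.inv)) = _
    rw [map_mul, atrans_mul]
    rfl

/-- The finite unitary group `U(n, F_{q²})` (with `q = p^fexp`), realized as the fixed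
points of the twisted Frobenius `F'` on `GL(n, F̄_p)`. -/
def Uprime (p : ℕ) [Fact p.Prime] (fexp n : ℕ) :
    Subgroup (Matrix (Fin n) (Fin n) (Fbar p))ˣ where
  carrier := {A | unitaryFrob p fexp n A = A}
  one_mem' := by simp
  mul_mem' := by
    intro a b ha hb
    simp only [Set.mem_setOf_eq, map_mul] at *
    rw [ha, hb]
  inv_mem' := by
    intro a ha
    simp only [Set.mem_setOf_eq, map_inv] at *
    rw [ha]

/-- The underlying matrix of an element of a subgroup of `GL(n, F̄_p)`. -/
def matOf {p : ℕ} [Fact p.Prime] {n : ℕ} {H : Subgroup (Matrix (Fin n) (Fin n) (Fbar p))ˣ}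
    (u : ↥H) : Matrix (Fin n) (Fin n) (Fbar p) :=
  ((u : (Matrix (Fin n) (Fin n) (Fbar p))ˣ) : Matrix (Fin n) (Fin n) (Fbar p))

/-- The subgroup (as a subset) of unipotent upper-triangular matrices in `H`. -/
def unitri {p : ℕ} [Fact p.Prime] {n : ℕ} (H : Subgroup (Matrix (Fin n) (Fin n) (Fbar p))ˣ) :
    Set ↥H :=
  {u | (∀ i j : Fin n, j < i → matOf u i j = 0) ∧ ∀ i : Fin n, matOf u i i = 1}

/-! ### Class function machinery -/

/-- The induced class function `Ind_B^G ψ (g) = |B|⁻¹ ∑_{x ∈ G, x⁻¹gx ∈ B} ψ(x⁻¹gx)`,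
for a subset `B` of `G` and `ψ : G → ℂ` (only the values of `ψ` on `B` matter). -/
def indChar {G : Type} [Group G] (B : Set G) (ψ : G → ℂ) : G → ℂ :=
  fun g => (Nat.card B : ℂ)⁻¹ * ∑ᶠ x : G, if x⁻¹ * g * x ∈ B then ψ (x⁻¹ * g * x) else 0

/-- The inner product `⟨f, h⟩ = |G|⁻¹ ∑_g f(g) \overline{h(g)}` of complex class
functions on a finite group. -/
def charInner {G : Type} (f h : G → ℂ) : ℂ :=
  (Nat.card G : ℂ)⁻¹ * ∑ᶠ g : G, f g * (starRingEnd ℂ) (h g)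

/-- `θ : G → ℂ` is the character of an irreducible (complex) representation of `G`. -/
def IsIrredChar (G : Type) [Group G] (θ : G → ℂ) : Prop :=
  ∃ V : FDRep ℂ G, CategoryTheory.Simple V ∧ θ = fun g => V.character g

/-- `M` is a unipotent matrix whose Jordan type is the partition `μ`, expressed through
the ranks of the powers of `M - 1`:  `rank((M-1)^k) = ∑_i max(μ_i - k, 0)` for all `k`. -/
def unipOfType {n : ℕ} {K : Type*} [Field K] (M : Matrix (Fin n) (Fin n) K)
    (mu : Partn) : Prop :=
  ∀ k : ℕ, ((M - 1) ^ k).rank = ∑ᶠ i, (mu.parts i - k)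

/-! ### Gelfand–Graev and degenerate Gelfand–Graev characters -/

/-- The sum of the superdiagonal entries `u_{i,i+1}`, `1 ≤ i ≤ ⌊n/2⌋`, `i ∉ S`,
of an element of the unitary group (in the `F'`-fixed, upper-triangular realization). -/
def sdSumU (p : ℕ) [Fact p.Prime] (fexp n : ℕ) (S : Set ℕ)
    (u : ↥(Uprime p fexp n)) : Fbar p :=
  ∑ i : Fin n, ∑ j : Fin n,
    if (j : ℕ) = (i : ℕ) + 1 ∧ (j : ℕ) ≤ n / 2 ∧ (j : ℕ) ∉ S then matOf u i j else 0

/-- The degenerate Gelfand–Graev character `Γ_{(k,ν)}` of `U(n, F_{q²})` (it depends only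
on `ν`; `k = n - 2|ν|`).  It is induced from the linear character
`u ↦ ψ₀(∑_{i ≤ ⌊n/2⌋, i ∉ ν_≤} u_{i,i+1})` of the unipotent upper-triangular subgroup,
where `ν_≤` is the set of partial sums of `ν`.  Taking `ν = ∅` gives the Gelfand–Graev
character `Γ_{(n)}`. -/
def GammaDGG (p : ℕ) [Fact p.Prime] (fexp n : ℕ) (ψ0 : Fbar p → ℂ) (nu : Partn) :
    ↥(Uprime p fexp n) → ℂ :=
  indChar (unitri (Uprime p fexp n)) (fun u => ψ0 (sdSumU p fexp n (cumSet nu) u))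

/-- The sum of all superdiagonal entries of an element of `GL(n, F_{p^r})`. -/
def sdSumGL (p : ℕ) [Fact p.Prime] (r n : ℕ) (u : ↥(GLfix p r n)) : Fbar p :=
  ∑ i : Fin n, ∑ j : Fin n, if (j : ℕ) = (i : ℕ) + 1 then matOf u i j else 0

/-- The Gelfand–Graev character of `GL(n, F_{p^r})`, induced from the generic linear
character `u ↦ ψ₀(u_{1,2} + u_{2,3} + ⋯ + u_{n-1,n})` of the unipotent upper-triangular
subgroup. -/
def GammaGL (p : ℕ) [Fact p.Prime] (r n : ℕ) (ψ0 : Fbar p → ℂ) : ↥(GLfix p r n) → ℂ :=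
  indChar (unitri (GLfix p r n)) (fun u => ψ0 (sdSumGL p r n u))

/-! ### Harish-Chandra induction from `GL(n, F_{q²})` to `U(2n, F_{q²})` -/

/-- The (maximally split) parabolic subgroup of `U(2n, F_{q²})` with Levi
`GL(n, F_{q²})`: block upper-triangular matrices. -/
def PsetGLU (p : ℕ) [Fact p.Prime] (fexp n : ℕ) : Set ↥(Uprime p fexp (2 * n)) :=
  {g | ∀ i j : Fin (2 * n), (j : ℕ) < n → n ≤ (i : ℕ) → matOf g i j = 0}

/-- Harish-Chandra induction `R_{GL(n,F_{q²})}^{U(2n,F_{q²})}` of a class function `θ` of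
`GL(n, F_{q²})`: inflate `θ` to the parabolic `P` through the Levi projection (upper-left
`n × n` block) and induce to `U(2n, F_{q²})`. -/
def HCIndGLtoU (p : ℕ) [Fact p.Prime] (fexp n : ℕ)
    (θ : ↥(GLfix p (2 * fexp) n) → ℂ) : ↥(Uprime p fexp (2 * n)) → ℂ :=
  fun g =>
    (Nat.card (PsetGLU p fexp n) : ℂ)⁻¹ *
      ∑ᶠ x : ↥(Uprime p fexp (2 * n)), ∑ᶠ l : ↥(GLfix p (2 * fexp) n),
        if x⁻¹ * g * x ∈ PsetGLU p fexp n ∧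
            (∀ i j : Fin n,
              matOf (x⁻¹ * g * x) (Fin.castLE (by omega) i) (Fin.castLE (by omega) j) =
                matOf l i j)
        then θ l else 0

/-! ### Core computation over a finite field -/

section core
variable {K : Type*} [Field K]

/-- Block matrix with lower-left block zero. -/
def bl {n : ℕ} (a : K) (s : Fin n → K) (M : Matrix (Fin n) (Fin n) K) :
    Matrix (Fin (n+1)) (Fin (n+1)) K :=
  Matrix.of (Fin.cons (Fin.cons a s) (fun i => Fin.cons 0 (M i)))

@[simp] lemma bl_zz {n : ℕ} (a : K) (s : Fin n → K) (M) : bl a s M 0 0 = a := rfl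
@[simp] lemma bl_zs {n : ℕ} (a : K) (s : Fin n → K) (M) (j) : bl a s M 0 (Fin.succ j) = s j := rfl
@[simp] lemma bl_sz {n : ℕ} (a : K) (s : Fin n → K) (M) (i) : bl a s M (Fin.succ i) 0 = 0 := rfl
@[simp] lemma bl_ss {n : ℕ} (a : K) (s : Fin n → K) (M) (i j) :
    bl a s M (Fin.succ i) (Fin.succ j) = M i j := rfl

lemma bl_mul {n : ℕ} (a b : K) (s t : Fin n → K) (M M' : Matrix (Fin n) (Fin n) K) :
    bl a s M * bl b t M' = bl (a * b) (a • t + Matrix.vecMul s M') (M * M') := by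
  ext i j
  refine Fin.cases ?_ (fun i => ?_) i <;> refine Fin.cases ?_ (fun j => ?_) j <;>
  simp [Matrix.mul_apply, Fin.sum_univ_succ, Matrix.vecMul, dotProduct]

lemma bl_inj {n : ℕ} {a b : K} {s t : Fin n → K} {M M' : Matrix (Fin n) (Fin n) K} :
    bl a s M = bl b t M' ↔ a = b ∧ s = t ∧ M = M' := by
  constructor
  · intro h
    refine ⟨by simpa using congrFun (congrFun h 0) 0, ?_, ?_⟩
    · ext j; simpa using congrFun (congrFun h 0) j.succ
    · ext i j; simpa using congrFun (congrFun h i.succ) j.succ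
  · rintro ⟨rfl, rfl, rfl⟩; rfl

lemma bl_eta {n : ℕ} (M : Matrix (Fin (n+1)) (Fin (n+1)) K) (h : ∀ i : Fin n, M i.succ 0 = 0) :
    M = bl (M 0 0) (fun j => M 0 j.succ) (Matrix.of fun i j => M i.succ j.succ) := by
  ext i j
  refine Fin.cases ?_ (fun i => ?_) i <;> refine Fin.cases ?_ (fun j => ?_) j <;> simp [h]

lemma bl_det {n : ℕ} (a : K) (s : Fin n → K) (M) : (bl a s M).det = a * M.det := by
  rw [Matrix.det_succ_column_zero, Fin.sum_univ_succ]
  simp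
  left
  congr 1

lemma bl_isUnit {n : ℕ} (s : Fin n → K) (M) : IsUnit (bl 1 s M) ↔ IsUnit M := by
  rw [Matrix.isUnit_iff_isUnit_det, Matrix.isUnit_iff_isUnit_det, bl_det, one_mul]

lemma bl_pow {n : ℕ} (s : Fin n → K) (M : Matrix (Fin n) (Fin n) K) (k : ℕ) :
    ∃ t, (bl 0 s M) ^ (k+1) = bl 0 t (M ^ (k+1)) := by
  induction k with
  | zero => exact ⟨s, by simp⟩
  | succ k ih =>
    obtain ⟨t, ht⟩ := ih
    exact ⟨_, by rw [pow_succ, ht, bl_mul, zero_mul, ← pow_succ]⟩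

/-- strictly upper triangular -/
def SU {n : ℕ} (u : Matrix (Fin n) (Fin n) K) : Prop := ∀ i j, j ≤ i → u i j = 0

lemma SU_bl {n : ℕ} (s : Fin n → K) (M) : SU (bl 0 s M) ↔ SU M := by
  constructor
  · intro h i j hij
    simpa using h i.succ j.succ (by simpa using hij)
  · intro h i j
    refine Fin.cases ?_ (fun i => ?_) i <;> refine Fin.cases ?_ (fun j => ?_) j
    · simp
    · simp
    · simp
    · intro hij; simpa using h i j (by simpa using hij)

lemma SU_col {n : ℕ} {u : Matrix (Fin (n+1)) (Fin (n+1)) K} (h : SU u) :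
    u 0 0 = 0 ∧ ∀ i : Fin n, u i.succ 0 = 0 :=
  ⟨h 0 0 le_rfl, fun _ => h _ _ (Fin.zero_le _)⟩

/-- first coordinate of a row vector, or zero -/
def fst0 {n : ℕ} (w : Fin n → K) : K := ∑ j : Fin n, if (j : ℕ) = 0 then w j else 0

def sd {n : ℕ} (u : Matrix (Fin n) (Fin n) K) : K :=
  ∑ i : Fin n, ∑ j : Fin n, if (j : ℕ) = (i : ℕ) + 1 then u i j else 0

lemma fst0_succ {n : ℕ} (w : Fin (n+1) → K) : fst0 w = w 0 := by
  simp [fst0]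

lemma sd_bl {n : ℕ} (s : Fin n → K) (M) : sd (bl 0 s M) = fst0 s + sd M := by
  simp [sd, fst0, Fin.sum_univ_succ]
  congr!

lemma fst0_add {n : ℕ} (v w : Fin n → K) : fst0 (v + w) = fst0 v + fst0 w := by
  cases n
  · simp [fst0]
  · simp [fst0_succ]

lemma fst0_sub {n : ℕ} (v w : Fin n → K) : fst0 (v - w) = fst0 v - fst0 w := by
  cases n
  · simp [fst0]
  · simp [fst0_succ]

lemma fst0_vecMul_SU {n : ℕ} (c : Fin n → K) (u : Matrix (Fin n) (Fin n) K) (hu : SU u) :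
    fst0 (Matrix.vecMul c u) = 0 := by
  cases n
  · simp [fst0]
  · rw [fst0_succ]; simp [Matrix.vecMul, dotProduct]
    exact Finset.sum_eq_zero fun i _ => by rw [hu i 0 (Fin.zero_le i), mul_zero]

variable [Fintype K]

/-- The weighted sum. -/
def FF (ψ : K → ℂ) {n : ℕ} (N : Matrix (Fin n) (Fin n) K) (l : Fin n → K) : ℂ :=
  ∑ x : Matrix (Fin n) (Fin n) K, ∑ u : Matrix (Fin n) (Fin n) K,
    if IsUnit x ∧ SU u ∧ N * x = x * u then ψ (fst0 (Matrix.vecMul l x) + sd u) else 0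

/-- parametrization of matrices with prescribed zero lower-left block -/
def blEquiv (n : ℕ) (a : K) : ((Fin n → K) × Matrix (Fin n) (Fin n) K) ≃
    {M : Matrix (Fin (n+1)) (Fin (n+1)) K // M 0 0 = a ∧ ∀ i : Fin n, M i.succ 0 = 0} where
  toFun p := ⟨bl a p.1 p.2, by simp⟩
  invFun M := (fun j => M.1 0 j.succ, Matrix.of fun i j => M.1 i.succ j.succ)
  left_inv p := by ext <;> simp
  right_inv M := by
    apply Subtype.ext
    have := bl_eta M.1 M.2.2
    rw [M.2.1] at this
    exact this.symm

lemma sum_bl {n : ℕ} (a : K) (f : Matrix (Fin (n+1)) (Fin (n+1)) K → ℂ)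
    (hf : ∀ M, f M ≠ 0 → M 0 0 = a ∧ ∀ i : Fin n, M i.succ 0 = 0) :
    ∑ M, f M = ∑ s : Fin n → K, ∑ M : Matrix (Fin n) (Fin n) K, f (bl a s M) := by
  rw [← Fintype.sum_prod_type' (f := fun s M => f (bl a s M))]
  rw [Fintype.sum_equiv (blEquiv n a) (fun p => f (bl a p.1 p.2)) (fun M => f M.1) (fun p => rfl)]
  rw [← Finset.sum_filter_of_ne (p := fun M : Matrix (Fin (n+1)) (Fin (n+1)) K =>
    M 0 0 = a ∧ ∀ i : Fin n, M i.succ 0 = 0) (fun M _ h => hf M h)]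
  exact Finset.sum_subtype _ (by simp) f

/-- The part of the sum with prescribed first column `e₁`. -/
lemma FF_inner (ψ : K → ℂ) {n : ℕ} (r : Fin n → K) (N' : Matrix (Fin n) (Fin n) K) :
    (∑ x : Matrix (Fin (n+1)) (Fin (n+1)) K, ∑ u : Matrix (Fin (n+1)) (Fin (n+1)) K,
      if (x 0 0 = 1 ∧ ∀ i : Fin n, x i.succ 0 = 0) ∧ IsUnit x ∧ SU u ∧ bl 0 r N' * x = x * u
        then ψ (sd u) else 0) = (Fintype.card K : ℂ) ^ n * FF ψ N' r := by
  rw [sum_bl 1]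
  swap
  · intro M hM
    by_contra h
    exact hM (Finset.sum_eq_zero fun u _ => by rw [if_neg (fun h' => h h'.1)])
  have key : ∀ (c : Fin n → K) (y : Matrix (Fin n) (Fin n) K),
      (∑ u : Matrix (Fin (n+1)) (Fin (n+1)) K,
      if (bl 1 c y 0 0 = 1 ∧ ∀ i : Fin n, bl 1 c y i.succ 0 = 0) ∧ IsUnit (bl 1 c y) ∧ SU u ∧
        bl 0 r N' * bl 1 c y = bl 1 c y * u
        then ψ (sd u) else 0) = ∑ u : Matrix (Fin n) (Fin n) K,
    if IsUnit y ∧ SU u ∧ N' * y = y * u then ψ (fst0 (Matrix.vecMul r y) + sd u) else 0 := by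
    intro c y
    rw [sum_bl 0]
    swap
    · intro M hM
      by_contra h
      exact hM (by rw [if_neg (fun h' => h (SU_col h'.2.2.1))])
    rw [Finset.sum_comm]
    refine Finset.sum_congr rfl fun u _ => ?_
    have e : ∀ s : Fin n → K, ((bl 1 c y 0 0 = 1 ∧ ∀ i : Fin n, bl 1 c y i.succ 0 = 0) ∧
        IsUnit (bl 1 c y) ∧ SU (bl 0 s u) ∧ bl 0 r N' * bl 1 c y = bl 1 c y * bl 0 s u) ↔
        (s = Matrix.vecMul r y - Matrix.vecMul c u ∧ (IsUnit y ∧ SU u ∧ N' * y = y * u)) := by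
      intro s
      rw [bl_isUnit, SU_bl, bl_mul, bl_mul, bl_inj]
      simp only [bl_zz, bl_sz, zero_mul, mul_zero, zero_smul, zero_add, one_smul, true_and,
        implies_true, eq_sub_iff_add_eq, eq_comm (a := Matrix.vecMul r y)]
      tauto
    simp only [e, ite_and]
    rw [Finset.sum_ite_eq' Finset.univ]
    simp only [Finset.mem_univ, if_true]
    by_cases hu : SU u
    · rw [sd_bl, fst0_sub, fst0_vecMul_SU c u hu, sub_zero]
    · simp [hu]
  simp only [key]
  simp [FF]

lemma exists_col {n : ℕ} (v : Fin (n+1) → K) (hv : v ≠ 0) :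
    ∃ x : Matrix (Fin (n+1)) (Fin (n+1)) K, IsUnit x ∧ x.col 0 = v := by
  have h1 : (Pi.single 0 1 : Fin (n+1) → K) ≠ 0 := by simp
  let f := (LinearEquiv.toSpanNonzeroSingleton K _ _ h1).symm ≪≫ₗ
    (LinearEquiv.toSpanNonzeroSingleton K _ _ hv)
  obtain ⟨g, hg⟩ := Submodule.exists_linearEquiv_restrict_eq f
  refine ⟨LinearMap.toMatrix' g.toLinearMap, ?_, ?_⟩
  · rw [Matrix.isUnit_iff_isUnit_det, LinearMap.det_toMatrix']
    exact LinearEquiv.isUnit_det' g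
  · have h2 := hg ⟨Pi.single 0 1, Submodule.mem_span_singleton_self _⟩
    ext i
    rw [Matrix.col_apply, LinearMap.toMatrix'_apply]
    have h3 : f ⟨Pi.single 0 1, Submodule.mem_span_singleton_self _⟩ =
      ⟨v, Submodule.mem_span_singleton_self _⟩ := by
      simp only [f, LinearEquiv.trans_apply]
      have h5 : (LinearEquiv.toSpanNonzeroSingleton K _ _ h1).symm
          ⟨Pi.single 0 1, Submodule.mem_span_singleton_self _⟩ = 1 := by
        rw [LinearEquiv.symm_apply_eq]
        exact Subtype.ext (by simp)
      rw [h5]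
      exact Subtype.ext (by simp)
    rw [h3] at h2
    have h4 : v i = g (Pi.single 0 1) i := congrFun h2 i
    rw [h4]
    rfl

/-- Conjugating the kernel vector to the first basis vector. -/
lemma exists_conj {n : ℕ} (N : Matrix (Fin (n+1)) (Fin (n+1)) K) (v : Fin (n+1) → K) (hv : v ≠ 0)
    (hN : N.mulVec v = 0) : ∃ x r N', IsUnit x ∧ x.col 0 = v ∧ N * x = x * bl 0 r N' := by
  obtain ⟨x, hx, hxv⟩ := exists_col v hv
  obtain ⟨y, rfl⟩ := hx
  have h0 : ∀ i, (((y⁻¹ : (Matrix (Fin (n+1)) (Fin (n+1)) K)ˣ) : Matrix (Fin (n+1)) (Fin (n+1)) K) * N * (y : Matrix (Fin (n+1)) (Fin (n+1)) K)) i 0 = 0 := by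
    intro i
    have : (((y⁻¹ : (Matrix (Fin (n+1)) (Fin (n+1)) K)ˣ) : Matrix (Fin (n+1)) (Fin (n+1)) K) * N * (y : Matrix (Fin (n+1)) (Fin (n+1)) K)) i 0 =
      (Matrix.mulVec ((y⁻¹ : (Matrix (Fin (n+1)) (Fin (n+1)) K)ˣ) : Matrix (Fin (n+1)) (Fin (n+1)) K)
        (N.mulVec ((y : Matrix (Fin (n+1)) (Fin (n+1)) K).col 0))) i := by
      rw [Matrix.mulVec_mulVec]; rfl
    rw [this, hxv, hN]; simp
  have := bl_eta _ (fun i => h0 i.succ)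
  rw [h0 0] at this
  refine ⟨y, _, _, y.isUnit, hxv, Eq.trans ?_ (congrArg (fun M => (y : Matrix (Fin (n+1)) (Fin (n+1)) K) * M) this)⟩
  rw [← mul_assoc, ← mul_assoc, Units.mul_inv, one_mul]

lemma FF_fiber (ψ : AddChar K ℂ) {n : ℕ} (N x0 : Matrix (Fin (n+1)) (Fin (n+1)) K)
    (l v : Fin (n+1) → K) (r : Fin n → K) (N' : Matrix (Fin n) (Fin n) K)
    (hx0 : IsUnit x0) (hv : x0.col 0 = v) (hN : N * x0 = x0 * bl 0 r N') :
    (∑ x : Matrix (Fin (n+1)) (Fin (n+1)) K, ∑ u : Matrix (Fin (n+1)) (Fin (n+1)) K,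
      if x.col 0 = v ∧ IsUnit x ∧ SU u ∧ N * x = x * u then
        ψ (fst0 (Matrix.vecMul l x) + sd u) else 0) =
      ψ (l ⬝ᵥ v) * ((Fintype.card K : ℂ) ^ n * FF ψ N' r) := by
  rw [← FF_inner, Finset.mul_sum]
  obtain ⟨y, rfl⟩ := hx0
  rw [← Equiv.sum_comp (Units.mulLeft y)]
  refine Finset.sum_congr rfl fun z _ => ?_
  rw [Finset.mul_sum]
  refine Finset.sum_congr rfl fun u _ => ?_
  rw [mul_ite, mul_zero]
  have hcol : ((Units.mulLeft y z : Matrix (Fin (n+1)) (Fin (n+1)) K).col 0 = v) ↔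
      (z 0 0 = 1 ∧ ∀ i : Fin n, z i.succ 0 = 0) := by
    have e1 : (Units.mulLeft y z : Matrix (Fin (n+1)) (Fin (n+1)) K).col 0 =
      Matrix.mulVec (y : Matrix (Fin (n+1)) (Fin (n+1)) K) (z.col 0) := rfl
    have e2 : v = Matrix.mulVec (y : Matrix (Fin (n+1)) (Fin (n+1)) K) (Pi.single 0 1) := by
      rw [← hv]; simp
    rw [e1, e2, (Matrix.mulVec_injective_of_isUnit y.isUnit).eq_iff, funext_iff, Fin.forall_fin_succ]
    simp
  have hcond : ((Units.mulLeft y z : Matrix (Fin (n+1)) (Fin (n+1)) K).col 0 = v ∧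
      IsUnit (Units.mulLeft y z : Matrix (Fin (n+1)) (Fin (n+1)) K) ∧ SU u ∧
      N * (Units.mulLeft y z) = (Units.mulLeft y z) * u) ↔
      ((z 0 0 = 1 ∧ ∀ i : Fin n, z i.succ 0 = 0) ∧ IsUnit z ∧ SU u ∧ bl 0 r N' * z = z * u) := by
    rw [hcol]
    simp only [Units.mulLeft_apply, Units.isUnit_units_mul]
    rw [← mul_assoc, hN, mul_assoc, mul_assoc, Units.mul_right_inj]
  by_cases h : ((z 0 0 = 1 ∧ ∀ i : Fin n, z i.succ 0 = 0) ∧ IsUnit z ∧ SU u ∧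
    bl 0 r N' * z = z * u)
  · rw [if_pos h, if_pos (hcond.mpr h), AddChar.map_add_eq_mul, fst0_succ]
    congr 2
    have := (hcond.mpr h).1
    rw [← this]; rfl
  · rw [if_neg h, if_neg (fun h' => h (hcond.mp h'))]

lemma FF_step (ψ : AddChar K ℂ) {n : ℕ} (N : Matrix (Fin (n+1)) (Fin (n+1)) K)
    (l : Fin (n+1) → K) (B : ℂ)
    (hB : ∀ x r N', IsUnit x → N * x = x * bl 0 r N' → FF ψ N' r = B) :
    FF ψ N l = (∑ v : Fin (n+1) → K, if v ≠ 0 ∧ N.mulVec v = 0 then ψ (l ⬝ᵥ v) else 0) *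
      ((Fintype.card K : ℂ) ^ n * B) := by
  rw [Finset.sum_mul, FF, ← Finset.sum_fiberwise Finset.univ
    (fun x : Matrix (Fin (n+1)) (Fin (n+1)) K => x.col 0)]
  refine Finset.sum_congr rfl fun v _ => ?_
  rw [Finset.sum_filter]
  have : ∀ x : Matrix (Fin (n+1)) (Fin (n+1)) K, (if x.col 0 = v then
      ∑ u : Matrix (Fin (n+1)) (Fin (n+1)) K, (if IsUnit x ∧ SU u ∧ N * x = x * u then
        ψ (fst0 (Matrix.vecMul l x) + sd u) else 0) else 0) =
      ∑ u : Matrix (Fin (n+1)) (Fin (n+1)) K,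
      if x.col 0 = v ∧ IsUnit x ∧ SU u ∧ N * x = x * u then
        ψ (fst0 (Matrix.vecMul l x) + sd u) else 0 := by
    intro x
    by_cases h : x.col 0 = v
    · simp [h]
    · simp [h]
  simp only [this]
  by_cases hv : v ≠ 0 ∧ N.mulVec v = 0
  · rw [if_pos hv]
    obtain ⟨x, r, N', h1, h2, h3⟩ := exists_conj N v hv.1 hv.2
    rw [FF_fiber ψ N x l v r N' h1 h2 h3, hB x r N' h1 h3]
  · rw [if_neg hv, zero_mul]
    refine Finset.sum_eq_zero fun x _ => Finset.sum_eq_zero fun u _ => if_neg ?_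
    rintro ⟨rfl, hx, hu, hxu⟩
    apply hv
    constructor
    · intro h0
      have : x.mulVec (Pi.single 0 1) = x.mulVec 0 := by simpa using h0
      have := Matrix.mulVec_injective_of_isUnit hx this
      simp at this
    · ext i
      have : (N * x) i 0 = (x * u) i 0 := by rw [hxu]
      rw [Matrix.mul_apply, Matrix.mul_apply] at this
      rw [Finset.sum_eq_zero (f := fun j => x i j * u j 0) (fun j _ => by
        rw [hu j 0 (Fin.zero_le j), mul_zero])] at this
      exact this

/-- dimension of the kernel -/
def dk {n : ℕ} (N : Matrix (Fin n) (Fin n) K) : ℕ :=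
  Module.finrank K (LinearMap.ker N.mulVecLin)

lemma dk_add_rank {n : ℕ} (N : Matrix (Fin n) (Fin n) K) : dk N + N.rank = n := by
  have := N.mulVecLin.finrank_range_add_finrank_ker
  rw [Module.finrank_fin_fun] at this
  rw [dk, Matrix.rank, add_comm, this]

lemma dk_conj {n : ℕ} (N M x : Matrix (Fin n) (Fin n) K) (hx : IsUnit x) (h : N * x = x * M) :
    dk N = dk M := by
  have h1 := Matrix.rank_mul_eq_left_of_isUnit_det x N ((Matrix.isUnit_iff_isUnit_det x).mp hx)
  have h2 := Matrix.rank_mul_eq_right_of_isUnit_det x M ((Matrix.isUnit_iff_isUnit_det x).mp hx)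
  have h3 := dk_add_rank N
  have h4 := dk_add_rank M
  rw [h, h2] at h1
  omega

def YY {n : ℕ} (r : Fin n → K) (N : Matrix (Fin n) (Fin n) K) : Submodule K (Fin n → K) where
  carrier := {w | r ⬝ᵥ w = 0 ∧ N.mulVec w = 0}
  zero_mem' := by simp
  add_mem' := by rintro a b ⟨h1, h2⟩ ⟨h3, h4⟩; simp [Matrix.mulVec_add, dotProduct_add, *]
  smul_mem' := by rintro c a ⟨h1, h2⟩; simp [Matrix.mulVec_smul, *]

lemma bl_mulVec {n : ℕ} (r : Fin n → K) (N : Matrix (Fin n) (Fin n) K) (v : Fin (n+1) → K) :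
    (bl 0 r N).mulVec v = 0 ↔ r ⬝ᵥ (Fin.tail v) = 0 ∧ N.mulVec (Fin.tail v) = 0 := by
  rw [funext_iff, Fin.forall_fin_succ, funext_iff]
  simp [Matrix.mulVec, dotProduct, Fin.sum_univ_succ, Fin.tail]

lemma dk_bl {n : ℕ} (r : Fin n → K) (N : Matrix (Fin n) (Fin n) K) :
    dk (bl 0 r N) = 1 + Module.finrank K (YY r N) := by
  have e : (K × YY r N) ≃ₗ[K] LinearMap.ker (bl 0 r N).mulVecLin :=
    { toFun := fun p => ⟨Fin.cons p.1 p.2.1, by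
        rw [LinearMap.mem_ker, Matrix.mulVecLin_apply, bl_mulVec, Fin.tail_cons]
        exact p.2.2⟩
      invFun := fun v => (v.1 0, ⟨Fin.tail v.1, by
        have := v.2
        rw [LinearMap.mem_ker, Matrix.mulVecLin_apply, bl_mulVec] at this
        exact this⟩)
      map_add' := by
        intro a b; ext i; refine Fin.cases ?_ (fun i => ?_) i <;> simp
      map_smul' := by
        intro a b; ext i; refine Fin.cases ?_ (fun i => ?_) i <;> simp
      left_inv := by intro p; ext <;> simp
      right_inv := by intro v; ext i; simp }
  rw [dk, ← e.finrank_eq, Module.finrank_prod, Module.finrank_self]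

lemma finrank_YY {n : ℕ} (r : Fin n → K) (N : Matrix (Fin n) (Fin n) K) :
    Module.finrank K (YY r N) + (if (∀ v, N.mulVec v = 0 → r ⬝ᵥ v = 0) then 0 else 1) = dk N := by
  let f : (LinearMap.ker N.mulVecLin) →ₗ[K] K :=
    (dotProductBilin K K r).domRestrict _
  have hY : YY r N = (LinearMap.ker f).map (Submodule.subtype _) := by
    ext w
    simp [YY, f]
  rw [hY, Submodule.finrank_map_subtype_eq]
  split_ifs with h
  · have : f = 0 := by
      ext v
      exact h v.1 v.2
    rw [this, LinearMap.ker_zero, finrank_top]; rfl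
  · apply Module.Dual.finrank_ker_add_one_of_ne_zero
    intro hf
    apply h
    intro v hv
    exact congrArg (fun g => g ⟨v, by simpa using hv⟩) hf

lemma char_sum (ψ : AddChar K ℂ) (hψ : ψ ≠ 1) {n : ℕ} (N : Matrix (Fin n) (Fin n) K)
    (l : Fin n → K) :
    (∑ v : Fin n → K, if v ≠ 0 ∧ N.mulVec v = 0 then ψ (l ⬝ᵥ v) else 0) =
      if (∀ v, N.mulVec v = 0 → l ⬝ᵥ v = 0) then (Fintype.card K : ℂ) ^ dk N - 1 else -1 := by
  let f : (LinearMap.ker N.mulVecLin) →ₗ[K] K := (dotProductBilin K K l).domRestrict _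
  let χ : AddChar (LinearMap.ker N.mulVecLin) ℂ := ψ.compAddMonoidHom f.toAddMonoidHom
  have h1 : (∑ v : Fin n → K, if N.mulVec v = 0 then ψ (l ⬝ᵥ v) else 0) = ∑ v, χ v := by
    rw [← Finset.sum_filter]
    exact Finset.sum_subtype _ (by simp) _
  have h2 : (∑ v : Fin n → K, if N.mulVec v = 0 then ψ (l ⬝ᵥ v) else 0) =
    (∑ v : Fin n → K, if v ≠ 0 ∧ N.mulVec v = 0 then ψ (l ⬝ᵥ v) else 0) + 1 := by
    rw [← Finset.sum_erase_add _ _ (Finset.mem_univ (0 : Fin n → K))]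
    rw [← Finset.sum_erase_add (f := fun v => if v ≠ 0 ∧ N.mulVec v = 0 then ψ (l ⬝ᵥ v) else 0)
      _ (Finset.mem_univ (0 : Fin n → K))]
    simp only [Matrix.mulVec_zero, dotProduct_zero, AddChar.map_zero_eq_one, ne_eq,
      not_true_eq_false, false_and, if_true, if_false, add_zero]
    congr 1
    refine Finset.sum_congr rfl fun v hv => ?_
    have : v ≠ 0 := Finset.ne_of_mem_erase hv
    simp [this]
  rw [← sub_eq_iff_eq_add.mpr h2, h1, AddChar.sum_eq_ite]
  have hχ : χ = 0 ↔ (∀ v, N.mulVec v = 0 → l ⬝ᵥ v = 0) := by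
    constructor
    · intro h v hv
      by_contra hne
      apply hψ
      ext t
      have := DFunLike.congr_fun h ((t / (l ⬝ᵥ v)) • ⟨v, hv⟩)
      have h3 : χ ((t / (l ⬝ᵥ v)) • ⟨v, hv⟩) = ψ t := by
        show ψ (l ⬝ᵥ ((t / (l ⬝ᵥ v)) • v)) = ψ t
        rw [dotProduct_smul, smul_eq_mul, div_mul_cancel₀ _ hne]
      rw [← h3, this]; rfl
    · intro h
      ext v
      show ψ (l ⬝ᵥ v.1) = 1
      rw [h v.1 v.2, AddChar.map_zero_eq_one]
  by_cases h : (∀ v, N.mulVec v = 0 → l ⬝ᵥ v = 0)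
  · rw [if_pos h, if_pos (hχ.mpr h), ← Nat.card_eq_fintype_card,
      Module.natCard_eq_pow_finrank (K := K), Nat.card_eq_fintype_card]
    push_cast
    rfl
  · rw [if_neg h, if_neg (fun h' => h (hχ.mp h'))]; simp

/-- The value. -/
def AA (q : ℂ) (n d : ℕ) : ℂ := (-1) ^ (n - d) * ∏ i ∈ Finset.range d, (q ^ (i+1) - 1)

theorem FF_main (ψ : AddChar K ℂ) (hψ : ψ ≠ 1) (n : ℕ) : ∀ (N : Matrix (Fin n) (Fin n) K)
    (l : Fin n → K), IsNilpotent N →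
    FF ψ N l = (Fintype.card K : ℂ) ^ (∑ i ∈ Finset.range n, i) *
      (if (∀ v, N.mulVec v = 0 → l ⬝ᵥ v = 0) then AA (Fintype.card K) n (dk N)
        else AA (Fintype.card K) n (dk N - 1)) := by
  induction n with
  | zero =>
    intro N l _
    have h : ∀ v, N.mulVec v = 0 → l ⬝ᵥ v = 0 := by intro v _; simp [dotProduct]
    have hd : dk N = 0 := by have := dk_add_rank N; omega
    rw [if_pos h, hd]
    simp [FF, AA, SU, fst0, sd, Fintype.card_eq_one_iff_nonempty_unique]
    exact ⟨⟨⟨0⟩, fun _ => Subsingleton.elim _ _⟩⟩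
  | succ n ih =>
    intro N l hN
    have hdet : N.det = 0 := by
      obtain ⟨k, hk⟩ := hN
      have : N.det ^ k = 0 := by
        rw [← Matrix.det_pow, hk]
        by_cases hk0 : k = 0
        · subst hk0
          have := congrFun (congrFun hk 0) 0
          simp at this
        · exact Matrix.det_zero
      exact eq_zero_of_pow_eq_zero this
    obtain ⟨v, hv, hNv⟩ := Matrix.exists_mulVec_eq_zero_iff.mpr hdet
    obtain ⟨d, hd⟩ : ∃ d, dk N = d + 1 := by
      obtain ⟨x, r, N', h1, h2, h3⟩ := exists_conj N v hv hNv
      refine ⟨_, (dk_conj _ _ _ h1 h3).trans ((dk_bl _ _).trans (add_comm _ _))⟩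
    have hle : d ≤ n := by have := dk_add_rank N; omega
    rw [FF_step ψ N l ((Fintype.card K : ℂ) ^ (∑ i ∈ Finset.range n, i) *
      AA (Fintype.card K) n d) ?_, char_sum ψ hψ, hd]
    · rw [Finset.sum_range_succ, pow_add]
      split_ifs
      · simp only [AA, Finset.prod_range_succ, Nat.add_sub_add_right]
        ring
      · simp only [AA, Nat.add_sub_cancel, Nat.succ_sub hle, pow_succ]
        ring
    · intro x r N' hx hxN
      have hnil : IsNilpotent N' := by
        obtain ⟨k, hk⟩ := hN
        refine ⟨k+1, ?_⟩
        obtain ⟨t, ht⟩ := bl_pow r N' k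
        have hs : SemiconjBy x (bl 0 r N') N := hxN.symm
        have h4 := (hs.pow_right (k+1)).eq
        rw [pow_succ N, hk, zero_mul, zero_mul] at h4
        have h5 : bl 0 r N' ^ (k+1) = 0 := by
          rcases hx with ⟨y, rfl⟩
          simpa using h4
        rw [ht] at h5
        ext i j
        simpa using congrFun (congrFun h5 i.succ) j.succ
      rw [ih N' r hnil]
      have e1 := finrank_YY r N'
      have e2 := dk_bl r N'
      rw [← dk_conj _ _ _ hx hxN, hd] at e2
      congr 1
      split_ifs with h
      · rw [if_pos h] at e1
        congr 1; omega
      · rw [if_neg h] at e1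
        congr 1; omega

lemma card_SU (n : ℕ) : (Nat.card {u : Matrix (Fin n) (Fin n) K // SU u} : ℂ) =
    (Fintype.card K : ℂ) ^ (∑ i ∈ Finset.range n, i) := by
  have h : ∀ n : ℕ, (Nat.card {u : Matrix (Fin n) (Fin n) K // SU u} : ℂ) =
      ∑ u : Matrix (Fin n) (Fin n) K, if SU u then 1 else 0 := by
    intro n
    rw [Nat.card_eq_fintype_card, Fintype.card_subtype]
    simp
  rw [h]
  induction n with
  | zero =>
    simp [SU, Fintype.card_eq_one_iff_nonempty_unique]
    exact ⟨⟨⟨0⟩, fun _ => Subsingleton.elim _ _⟩⟩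
  | succ n ih =>
    rw [sum_bl 0]
    · simp only [SU_bl, ih]
      rw [Finset.sum_range_succ, pow_add]
      simp [mul_comm]
    · intro M hM
      by_contra h
      exact hM (if_neg fun h' => h (SU_col h'))

end core

/-! ### The unipotent/partition side -/

lemma rank_map_field {K L : Type*} [Field K] [Field L] (f : K →+* L) {n : ℕ}
    (A : Matrix (Fin n) (Fin n) K) : (A.map f).rank = A.rank := by
  obtain ⟨L1, L2, D, h⟩ :=
    Matrix.Pivot.exists_list_transvec_mul_mul_list_transvec_eq_diagonal A
  have hu1 : IsUnit (L1.map Matrix.TransvectionStruct.toMatrix).prod.det := by simp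
  have hu2 : IsUnit (L2.map Matrix.TransvectionStruct.toMatrix).prod.det := by simp
  generalize (L1.map Matrix.TransvectionStruct.toMatrix).prod = P at *
  generalize (L2.map Matrix.TransvectionStruct.toMatrix).prod = Q at *
  have e1 : A.rank = (Matrix.diagonal D).rank := by
    rw [← h, Matrix.rank_mul_eq_left_of_isUnit_det _ _ hu2,
      Matrix.rank_mul_eq_right_of_isUnit_det _ _ hu1]
  have h' : P.map f * A.map f * Q.map f = Matrix.diagonal (fun i => f (D i)) := by
    rw [← Matrix.map_mul, ← Matrix.map_mul, h, Matrix.diagonal_map (map_zero f)]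
  have hP : IsUnit (P.map f).det := by
    have := hu1.map f
    rwa [RingHom.map_det] at this
  have hQ : IsUnit (Q.map f).det := by
    have := hu2.map f
    rwa [RingHom.map_det] at this
  have e2 : (A.map f).rank = (Matrix.diagonal (fun i => f (D i))).rank := by
    rw [← h', Matrix.rank_mul_eq_left_of_isUnit_det _ _ hQ,
      Matrix.rank_mul_eq_right_of_isUnit_det _ _ hP]
  rw [e1, e2, Matrix.rank_diagonal, Matrix.rank_diagonal]
  simp

lemma SU_nilpotent {K : Type*} [Field K] {n : ℕ} (u : Matrix (Fin n) (Fin n) K) (hu : SU u) :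
    IsNilpotent u := by
  have ht : u.BlockTriangular id := fun i j hij => hu i j (le_of_lt hij)
  have h := Matrix.charpoly_of_isUpperTriangular u ht
  have h2 := Matrix.aeval_self_charpoly u
  rw [h] at h2
  refine ⟨n, ?_⟩
  have : ∀ i, u i i = 0 := fun i => hu i i le_rfl
  simpa [this] using h2

lemma finsum_eq_range (f : ℕ → ℕ) (m : ℕ) (h : ∀ i, m ≤ i → f i = 0) :
    ∑ᶠ i, f i = ∑ i ∈ Finset.range m, f i := by
  apply finsum_eq_sum_of_support_subset
  intro i hi
  simp only [Finset.coe_range, Set.mem_Iio]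
  by_contra hh
  exact hi (h i (by omega))

/-- Partitions from antitone rank differences. -/
lemma exists_partn (r δ : ℕ → ℕ) (m : ℕ) (hδ : Antitone δ) (hr : ∀ k, r k = r (k+1) + δ k)
    (hm : ∀ k, m ≤ k → r k = 0) : ∃ mu : Partn, ∀ k, r k = ∑ᶠ i, (mu.parts i - k) := by
  let c : ℕ → ℕ := fun i => ((Finset.range m).filter fun j => i ≤ δ j).card
  have hc0 : ∀ i, δ 0 + 1 ≤ i → c i = 0 := by
    intro i hi
    simp only [c, Finset.card_eq_zero, Finset.filter_eq_empty_iff]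
    intro j _ hj
    have := hδ (Nat.zero_le j)
    omega
  refine ⟨⟨fun i => if i = 0 then 0 else c i, by simp, ?_, ?_⟩, ?_⟩
  · intro i j hi hij
    have h1 : i ≠ 0 := by omega
    have h2 : j ≠ 0 := by omega
    simp only [h1, h2, if_false]
    apply Finset.card_le_card
    intro x hx
    simp only [Finset.mem_filter] at hx ⊢
    exact ⟨hx.1, hij.trans hx.2⟩
  · apply Set.Finite.subset (Set.finite_Iio (δ 0 + 1))
    intro i hi
    simp only [Set.mem_Iio]
    by_contra hh
    apply hi
    simp [hc0 i (by omega)]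
  · intro k
    rw [finsum_eq_range _ (δ 0 + 1) (by intro i hi; simp [hc0 i hi])]
    have h1 : ∀ i, c i - k = ((Finset.Ico k m).filter fun j => i ≤ δ j).card := by
      intro i
      by_cases hk : k ≤ m
      · by_cases hik : ∀ j < k, i ≤ δ j
        · have : c i = k + ((Finset.Ico k m).filter fun j => i ≤ δ j).card := by
            simp only [c]
            rw [Finset.range_eq_Ico, ← Finset.Ico_union_Ico_eq_Ico (Nat.zero_le k) hk,
              Finset.filter_union, Finset.card_union_of_disjoint]
            · congr 1
              rw [Finset.filter_true_of_mem]
              · simp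
              · intro j hj; exact hik j (by simpa using hj)
            · apply Finset.disjoint_filter_filter
              exact Finset.Ico_disjoint_Ico_consecutive 0 k m
          omega
        · push Not at hik
          obtain ⟨j0, hj0, hlt⟩ := hik
          have e1 : c i ≤ k := by
            calc c i ≤ (Finset.range k).card := by
                  apply Finset.card_le_card
                  intro j hj
                  simp only [Finset.mem_filter, Finset.mem_range] at hj ⊢
                  by_contra hh
                  have := hδ (show j0 ≤ j by omega)
                  omega
              _ = k := Finset.card_range k
          have e2 : ((Finset.Ico k m).filter fun j => i ≤ δ j).card = 0 := by
            rw [Finset.card_eq_zero, Finset.filter_eq_empty_iff]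
            intro j hj
            simp only [Finset.mem_Ico] at hj
            have := hδ (show j0 ≤ j by omega)
            omega
          omega
      · have e1 : c i ≤ m := by
          calc c i ≤ (Finset.range m).card := Finset.card_filter_le _ _
            _ = m := Finset.card_range m
        rw [Finset.Ico_eq_empty_of_le (by omega)]
        simp; omega
    rw [Finset.sum_range_succ']
    simp only [Nat.add_eq_zero_iff, one_ne_zero, and_false, if_false, if_true, h1, Nat.zero_sub,
      add_zero]
    simp only [Finset.card_filter]
    rw [Finset.sum_comm]
    have h2 : ∀ j, (∑ i ∈ Finset.range (δ 0), if i + 1 ≤ δ j then 1 else 0) = δ j := by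
      intro j
      rw [← Finset.card_filter]
      have : (Finset.range (δ 0)).filter (fun i => i + 1 ≤ δ j) = Finset.range (δ j) := by
        ext i
        have := hδ (Nat.zero_le j)
        simp only [Finset.mem_filter, Finset.mem_range]
        omega
      rw [this, Finset.card_range]
    simp only [h2]
    by_cases hk : k ≤ m
    · have h3 : ∀ t, r k = r (k + t) + ∑ j ∈ Finset.Ico k (k+t), δ j := by
        intro t
        induction t with
        | zero => simp
        | succ t ih =>
          rw [← add_assoc, Finset.sum_Ico_succ_top (by omega), ih, hr (k+t)]
          ring
      have := h3 (m - k)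
      rw [Nat.add_sub_cancel' hk, hm m le_rfl, zero_add] at this
      exact this
    · rw [Finset.Ico_eq_empty_of_le (by omega), hm k (by omega)]; simp

lemma exists_type {K : Type*} [Field K] {n : ℕ} (M : Matrix (Fin n) (Fin n) K)
    (h : IsNilpotent (M - 1)) : ∃ mu, unipOfType M mu := by
  obtain ⟨m, hm⟩ := h
  set N := M - 1 with hN
  let δ : ℕ → ℕ := fun k => Module.finrank K
    ((LinearMap.ker N.mulVecLin ⊓ LinearMap.range (N ^ k).mulVecLin : Submodule K (Fin n → K)))
  have hcomp : ∀ k, (N ^ (k+1)).mulVecLin = N.mulVecLin ∘ₗ (N ^ k).mulVecLin := by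
    intro k; rw [pow_succ', Matrix.mulVecLin_mul]
  have hcomp' : ∀ k, (N ^ (k+1)).mulVecLin = (N ^ k).mulVecLin ∘ₗ N.mulVecLin := by
    intro k; rw [pow_succ, Matrix.mulVecLin_mul]
  refine exists_partn (fun k => (N ^ k).rank) δ m ?_ ?_ ?_
  · apply antitone_nat_of_succ_le
    intro k
    apply Submodule.finrank_mono
    apply inf_le_inf_left
    rw [hcomp']
    exact LinearMap.range_comp_le_range _ _
  · intro k
    have := LinearMap.finrank_range_add_finrank_ker
      (N.mulVecLin.domRestrict (LinearMap.range (N ^ k).mulVecLin))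
    have e1 : LinearMap.range (N.mulVecLin.domRestrict (LinearMap.range (N ^ k).mulVecLin)) =
        LinearMap.range (N ^ (k+1)).mulVecLin := by
      rw [hcomp, LinearMap.range_domRestrict, LinearMap.range_comp]
    have e2 : Module.finrank K
        (LinearMap.ker (N.mulVecLin.domRestrict (LinearMap.range (N ^ k).mulVecLin))) = δ k := by
      simp only [δ]
      rw [← Submodule.finrank_map_subtype_eq]
      congr 2
      all_goals
        ext w
        simp
        try tauto
    rw [e1, e2] at this
    exact this.symm
  · intro k hk
    have : N ^ k = 0 := pow_eq_zero_of_le hk hm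
    show (N ^ k).rank = 0
    rw [this, Matrix.rank_zero]

lemma len_add_rank {K : Type*} [Field K] {n : ℕ} (M : Matrix (Fin n) (Fin n) K) (mu : Partn)
    (h : unipOfType M mu) : mu.len + (M - 1).rank = n ∧ IsNilpotent (M - 1) := by
  have h0 := h 0
  have h1 := h 1
  rw [pow_zero, Matrix.rank_one, Fintype.card_fin] at h0
  rw [pow_one] at h1
  obtain ⟨B, hB⟩ := mu.parts_finite.bddAbove
  have hz : ∀ i, B + 1 ≤ i → mu.parts i = 0 := by
    intro i hi
    by_contra hh
    have := hB hh
    omega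
  rw [finsum_eq_range _ (B+1) (fun i hi => by simp [hz i hi])] at h0 h1
  constructor
  · have hl : mu.len = ∑ i ∈ Finset.range (B+1), if mu.parts i ≠ 0 then 1 else 0 := by
      rw [← Finset.card_filter, Partn.len, Set.ncard_eq_toFinset_card _ mu.parts_finite]
      congr 1
      ext i
      simp only [Set.Finite.mem_toFinset, Set.mem_ofPred_eq, Finset.mem_filter, Finset.mem_range]
      constructor
      · intro hi
        refine ⟨?_, hi⟩
        by_contra hh
        exact hi (hz i (by omega))
      · exact fun hi => hi.2
    rw [hl, h1, ← Finset.sum_add_distrib, h0]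
    refine Finset.sum_congr rfl fun i _ => ?_
    split_ifs with hh <;> omega
  · refine ⟨mu.parts 1, ?_⟩
    have h2 := h (mu.parts 1)
    rw [finsum_eq_range _ 0] at h2
    · rw [Finset.range_zero, Finset.sum_empty] at h2
      rw [Matrix.rank, Submodule.finrank_eq_zero, LinearMap.range_eq_bot] at h2
      have h3 := congrArg LinearMap.toMatrix' h2
      rw [← Matrix.toLin'_apply', LinearMap.toMatrix'_toLin'] at h3
      simpa using h3
    · intro i _
      by_cases hi : i = 0
      · rw [hi, mu.parts_zero]; simp
      · have := mu.parts_antitone le_rfl (show 1 ≤ i by omega)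
        omega

/-! ### Transfer to `GLfix` -/

section transfer
variable (p : ℕ) [Fact p.Prime] (f : ℕ)

/-- The field of fixed points of Frobenius. -/
def Kf : Subfield (Fbar p) := (frobPow p f).eqLocusField (RingHom.id _)

lemma mem_Kf (a : Fbar p) : a ∈ Kf p f ↔ a ^ p ^ f = a := by
  rw [Kf, RingHom.mem_eqLocusField, frobPow]
  simp [iterateFrobenius_def]

lemma Kf_card (hf : 0 < f) : Nat.card (Kf p f) = p ^ f := by
  have hp : 1 < p := (Fact.out : p.Prime).one_lt
  have aux : (Polynomial.X ^ p ^ f - Polynomial.X : Polynomial (ZMod p)) ≠ 0 :=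
    FiniteField.X_pow_card_pow_sub_X_ne_zero _ hf.ne' hp
  have key : Fintype.card ((Polynomial.X ^ p ^ f - Polynomial.X : Polynomial (ZMod p)).rootSet
      (Fbar p)) = (Polynomial.X ^ p ^ f - Polynomial.X : Polynomial (ZMod p)).natDegree :=
    Polynomial.card_rootSet_eq_natDegree (galois_poly_separable p _ (dvd_pow (dvd_refl p) hf.ne'))
      (IsAlgClosed.splits _)
  rw [FiniteField.X_pow_card_pow_sub_X_natDegree_eq _ hf.ne' hp, ← Nat.card_eq_fintype_card] at key
  rw [← key]
  refine Nat.card_congr (Equiv.subtypeEquivRight fun a => ?_)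
  rw [Polynomial.mem_rootSet_of_ne aux, mem_Kf]
  simp [sub_eq_zero]

lemma Kf_finite (hf : 0 < f) : Finite (Kf p f) := by
  apply Nat.finite_of_card_ne_zero
  rw [Kf_card p f hf]
  exact pow_ne_zero _ (Fact.out : p.Prime).ne_zero

variable (n : ℕ)

lemma mem_GLfix (A : (Matrix (Fin n) (Fin n) (Fbar p))ˣ) :
    A ∈ GLfix p f n ↔ ∀ i j, (A : Matrix (Fin n) (Fin n) (Fbar p)) i j ∈ Kf p f := by
  show entryFrobGL p f n A = A ↔ _
  rw [Units.ext_iff, ← Matrix.ext_iff]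
  rfl

/-- `GL(n, F_q)` inside `GL(n, F̄_p)`. -/
def PhiHom : (Matrix (Fin n) (Fin n) (Kf p f))ˣ →* GLfix p f n :=
  (Units.map ((Kf p f).subtype.mapMatrix.toMonoidHom)).codRestrict (GLfix p f n) (by
    intro A
    rw [mem_GLfix]
    intro i j
    exact (A.1 i j).2)

lemma matOf_Phi (A : (Matrix (Fin n) (Fin n) (Kf p f))ˣ) :
    matOf (PhiHom p f n A) = A.1.map (Kf p f).subtype := rfl

lemma map_sub_inj {A B : Matrix (Fin n) (Fin n) (Kf p f)}
    (h : A.map (Kf p f).subtype = B.map (Kf p f).subtype) : A = B :=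
  Matrix.map_injective (Kf p f).subtype.injective h

lemma Phi_bij : Function.Bijective (PhiHom p f n) := by
  constructor
  · intro A B h
    apply Units.ext
    apply map_sub_inj
    rw [← matOf_Phi, ← matOf_Phi, h]
  · intro B
    have h1 := (mem_GLfix p f n B.1).mp B.2
    have h2 := (mem_GLfix p f n (B⁻¹).1).mp (B⁻¹).2
    let A : Matrix (Fin n) (Fin n) (Kf p f) := Matrix.of fun i j => ⟨_, h1 i j⟩
    let A' : Matrix (Fin n) (Fin n) (Kf p f) := Matrix.of fun i j => ⟨_, h2 i j⟩
    have eA : A.map (Kf p f).subtype = (B.1 : Matrix (Fin n) (Fin n) (Fbar p)) := rfl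
    have eA' : A'.map (Kf p f).subtype =
      ((B.1⁻¹ : (Matrix (Fin n) (Fin n) (Fbar p))ˣ) : Matrix (Fin n) (Fin n) (Fbar p)) := rfl
    refine ⟨⟨A, A', ?_, ?_⟩, ?_⟩
    · apply map_sub_inj
      rw [Matrix.map_mul, eA, eA', Units.mul_inv, Matrix.map_one _ (map_zero _) (map_one _)]
    · apply map_sub_inj
      rw [Matrix.map_mul, eA, eA', Units.inv_mul, Matrix.map_one _ (map_zero _) (map_one _)]
    · apply Subtype.ext
      apply Units.ext
      exact eA

lemma unitri_Phi (A : (Matrix (Fin n) (Fin n) (Kf p f))ˣ) :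
    PhiHom p f n A ∈ unitri (GLfix p f n) ↔ SU (A.1 - 1) := by
  show ((∀ i j : Fin n, j < i → matOf (PhiHom p f n A) i j = 0) ∧
    ∀ i : Fin n, matOf (PhiHom p f n A) i i = 1) ↔ _
  rw [matOf_Phi]
  simp only [Matrix.map_apply, Subfield.coe_subtype, SU, Matrix.sub_apply]
  constructor
  · rintro ⟨h1, h2⟩ i j hij
    rcases hij.lt_or_eq with h | rfl
    · rw [Matrix.one_apply_ne (ne_of_gt h), sub_zero]
      exact Subtype.ext (h1 i j h)
    · rw [Matrix.one_apply_eq, sub_eq_zero]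
      exact Subtype.ext (h2 j)
  · intro h
    refine ⟨fun i j hij => ?_, fun i => ?_⟩
    · have := h i j hij.le
      rw [Matrix.one_apply_ne (ne_of_gt hij), sub_zero] at this
      rw [this]; rfl
    · have := h i i le_rfl
      rw [Matrix.one_apply_eq, sub_eq_zero] at this
      rw [this]; rfl

lemma SU_isUnit {K : Type*} [Field K] {n : ℕ} (u : Matrix (Fin n) (Fin n) K) (hu : SU u) :
    IsUnit (u + 1) := (SU_nilpotent u hu).isUnit_add_one

lemma card_unitri : Nat.card (unitri (GLfix p f n)) =
    Nat.card {u : Matrix (Fin n) (Fin n) (Kf p f) // SU u} := by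
  symm
  refine Nat.card_congr (Equiv.ofBijective
    (fun u => ⟨PhiHom p f n (SU_isUnit u.1 u.2).unit, ?_⟩) ⟨?_, ?_⟩)
  · rw [unitri_Phi]
    simpa using u.2
  · intro u v h
    have h1 := (Phi_bij p f n).1 (congrArg Subtype.val h)
    have h2 := congrArg Units.val h1
    simp only [IsUnit.unit_spec] at h2
    exact Subtype.ext (add_right_cancel h2)
  · rintro ⟨B, hB⟩
    obtain ⟨A, rfl⟩ := (Phi_bij p f n).2 B
    rw [unitri_Phi] at hB
    refine ⟨⟨A.1 - 1, hB⟩, ?_⟩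
    apply Subtype.ext
    show PhiHom p f n _ = _
    congr 1
    apply Units.ext
    simp

lemma sd_Phi (A : (Matrix (Fin n) (Fin n) (Kf p f))ˣ) :
    sdSumGL p f n (PhiHom p f n A) = ((sd (A.1 - 1) : Kf p f) : Fbar p) := by
  have : sd (A.1 - 1) = sd A.1 := by
    simp only [sd]
    refine Finset.sum_congr rfl fun i _ => Finset.sum_congr rfl fun j _ => ?_
    split_ifs with h
    · rw [Matrix.sub_apply, Matrix.one_apply_ne, sub_zero]
      rintro rfl
      omega
    · rfl
  rw [this, sdSumGL, sd, matOf_Phi]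
  show _ = (Kf p f).subtype _
  simp only [map_sum]
  refine Finset.sum_congr rfl fun i _ => Finset.sum_congr rfl fun j _ => ?_
  split_ifs <;> simp

lemma FF_eq {K : Type*} [Field K] [Fintype K] (ψ : K → ℂ) {n : ℕ}
    (N : Matrix (Fin n) (Fin n) K) :
    FF ψ N 0 = ∑ x : (Matrix (Fin n) (Fin n) K)ˣ,
      if SU ((x⁻¹ : (Matrix (Fin n) (Fin n) K)ˣ).1 * N * x.1)
        then ψ (sd ((x⁻¹ : (Matrix (Fin n) (Fin n) K)ˣ).1 * N * x.1)) else 0 := by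
  rw [FF, ← Finset.sum_filter_of_ne (p := fun x => IsUnit x)]
  swap
  · intro x _ h
    by_contra hx
    exact h (Finset.sum_eq_zero fun u _ => if_neg fun h' => hx h'.1)
  symm
  refine Finset.sum_bij (fun x _ => x.1) ?_ ?_ ?_ ?_
  · intro x _; simp
  · intro x _ y _ h; exact Units.ext h
  · intro x hx
    simp only [Finset.mem_filter, Finset.mem_univ, true_and] at hx
    exact ⟨hx.unit, Finset.mem_univ _, rfl⟩
  · intro x _
    have e : ∀ u, (IsUnit x.1 ∧ SU u ∧ N * x.1 = x.1 * u) ↔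
        (u = (x⁻¹ : (Matrix (Fin n) (Fin n) K)ˣ).1 * N * x.1 ∧ SU u) := by
      intro u
      have : N * x.1 = x.1 * u ↔ u = (x⁻¹ : (Matrix (Fin n) (Fin n) K)ˣ).1 * N * x.1 := by
        rw [mul_assoc, Units.eq_inv_mul_iff_mul_eq, eq_comm]
      rw [this]
      simp [and_comm]
    simp only [e, ite_and]
    rw [Finset.sum_ite_eq' Finset.univ]
    simp [Matrix.zero_vecMul, fst0]

lemma finsum_aux {α : Type*} {inst : Fintype α} (F : α → ℂ) :
    ∑ᶠ x, F x = @Finset.sum α ℂ _ (@Finset.univ α inst) F := finsum_eq_sum_of_fintype F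

lemma GammaGL_Phi [Fintype (Kf p f)] (ψ0 : Fbar p → ℂ) (h : (Matrix (Fin n) (Fin n) (Kf p f))ˣ) :
    GammaGL p f n ψ0 (PhiHom p f n h) =
      ((Fintype.card (Kf p f) : ℂ) ^ (∑ i ∈ Finset.range n, i))⁻¹ *
        FF (fun a : Kf p f => ψ0 a) (h.1 - 1) 0 := by
  rw [GammaGL, indChar, card_unitri, card_SU, FF_eq]
  congr 1
  refine Eq.trans (Eq.symm ?_) (finsum_aux _)
  refine finsum_eq_of_bijective (PhiHom p f n) (Phi_bij p f n) fun x => ?_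
  rw [← map_inv, ← map_mul, ← map_mul, sd_Phi]
  have e : (x⁻¹ * h * x).1 - 1 = (x⁻¹).1 * (h.1 - 1) * x.1 := by
    rw [mul_sub, sub_mul, mul_one, Units.inv_mul]; rfl
  simp only [unitri_Phi, e]

end transfer

/-- Theorem of Green/Howe–Zworski.  The Gelfand–Graev character
`Γ̃_(n)` of `GL(n, F_q)` vanishes on non-unipotent classes, and on a unipotent class of
type `μ ⊢ n` takes the value `(-1)^{n - ℓ(μ)} ∏_{i=1}^{ℓ(μ)} (q^i - 1)`. -/
theorem gelfandGraev_values_GL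
    (p : ℕ) [Fact p.Prime] (fexp : ℕ) (hf : 0 < fexp) (n : ℕ)
    (ψ0 : Fbar p → ℂ)
    (hψ0_zero : ψ0 0 = 1)
    (hψ0_add : ∀ a b : Fbar p, a ^ p ^ fexp = a → b ^ p ^ fexp = b →
      ψ0 (a + b) = ψ0 a * ψ0 b)
    (hψ0_nt : ∃ t : Fbar p, t ^ p ^ fexp = t ∧ ψ0 t ≠ 1)
    (g : ↥(GLfix p fexp n)) :
    ((∀ mu : Partn, ¬ unipOfType (matOf g) mu) → GammaGL p fexp n ψ0 g = 0) ∧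
      ∀ mu : Partn, unipOfType (matOf g) mu →
        GammaGL p fexp n ψ0 g =
          (-1 : ℂ) ^ (n - mu.len) *
            ∏ i ∈ Finset.range mu.len, (((p : ℂ) ^ fexp) ^ (i + 1) - 1) := by
  obtain ⟨h, rfl⟩ := (Phi_bij p fexp n).2 g
  haveI := Kf_finite p fexp hf
  letI : Fintype (Kf p fexp) := Fintype.ofFinite _
  have hq : (Fintype.card (Kf p fexp) : ℂ) = (p : ℂ) ^ fexp := by
    rw [← Nat.card_eq_fintype_card, Kf_card p fexp hf]; push_cast; rfl
  let ψ : AddChar (Kf p fexp) ℂ :=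
    { toFun := fun a => ψ0 a
      map_zero_eq_one' := hψ0_zero
      map_add_eq_mul' := fun a b =>
        hψ0_add a b ((mem_Kf p fexp _).mp a.2) ((mem_Kf p fexp _).mp b.2) }
  have hψ : ψ ≠ 1 := by
    obtain ⟨t, ht, hne⟩ := hψ0_nt
    intro h1
    exact hne (DFunLike.congr_fun h1 (⟨t, (mem_Kf p fexp t).mpr ht⟩ : Kf p fexp))
  have hmap : matOf (PhiHom p fexp n h) - 1 = (h.1 - 1).map (Kf p fexp).subtype := by
    rw [matOf_Phi, Matrix.map_sub _ (map_sub _), Matrix.map_one _ (map_zero _) (map_one _)]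
  have hnil : IsNilpotent (matOf (PhiHom p fexp n h) - 1) ↔ IsNilpotent (h.1 - 1) := by
    rw [hmap]
    exact IsNilpotent.map_iff (f := (Kf p fexp).subtype.mapMatrix)
      (Matrix.map_injective (Kf p fexp).subtype.injective)
  rw [GammaGL_Phi]
  constructor
  · intro hno
    rw [FF_eq]
    refine mul_eq_zero_of_right _ (Finset.sum_eq_zero fun x _ => ?_)
    rw [if_neg]
    intro hSU
    have hn := SU_nilpotent _ hSU
    have hn' : IsNilpotent (h.1 - 1) := by
      obtain ⟨k, hk⟩ := hn
      refine ⟨k, ?_⟩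
      rw [Units.conj_pow'] at hk
      have hk2 := congrArg (fun M => x.1 * M * (x⁻¹).1) hk
      simpa only [mul_assoc, Units.mul_inv, mul_one, Units.mul_inv_cancel_left, mul_zero,
        zero_mul] using hk2
    obtain ⟨mu, hmu⟩ := exists_type _ (hnil.mpr hn')
    exact hno mu hmu
  · intro mu hmu
    obtain ⟨h1, h2⟩ := len_add_rank _ _ hmu
    rw [hmap, rank_map_field] at h1
    have h3 := dk_add_rank (h.1 - 1)
    have h4 : dk (h.1 - 1) = mu.len := by omega
    have h5 := FF_main ψ hψ n (h.1 - 1) 0 (hnil.mp h2)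
    rw [if_pos (by simp), h4, hq] at h5
    have h6 : ((p : ℂ) ^ fexp) ^ (∑ i ∈ Finset.range n, i) ≠ 0 :=
      pow_ne_zero _ (pow_ne_zero _ (Nat.cast_ne_zero.mpr (Fact.out : p.Prime).ne_zero))
    have h7 : FF (fun a : Kf p fexp => ψ0 a) (h.1 - 1) 0 = FF ψ (h.1 - 1) 0 := rfl
    rw [h7, h5, hq, inv_mul_cancel_left₀ h6, AA]

end GGU
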